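/- Fix an integer n ≥ 1. There exists a constant c(n) > 0 depending only on n with the following property. Let h : ℝ → ℝ be C² with h(s) ≥ 0, h'(s) ≤ 0 and h'(s) ≤ h''(s) for all s ∈ ℝ. Then for every R > 0, every smooth positive solution u of Δu + u h(ln u) = 0 on the ball B_{2R} ⊂ ℝⁿ satisfies |∇u|²/u² + h(ln u) ≤ c(n)/R² and |∇u|/u ≤ √(c(n))/R at every point of B_R. -/

import Mathlib

open Real Metric

/-- The Euclidean Laplacian: trace of the Hessian. -/
noncomputable def lap {n : ℕ} (f : EuclideanSpace ℝ (Fin n) → ℝ)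
    (x : EuclideanSpace ℝ (Fin n)) : ℝ :=
  ∑ i : Fin n,
    fderiv ℝ (fun y => fderiv ℝ f y (EuclideanSpace.single i 1)) x
      (EuclideanSpace.single i 1)

open Filter Topology

/-- The partial derivative of `f` in the `i`-th coordinate direction. -/
noncomputable def partialDeriv {n : ℕ} (i : Fin n) (f : EuclideanSpace ℝ (Fin n) → ℝ)
    (x : EuclideanSpace ℝ (Fin n)) : ℝ :=
  fderiv ℝ f x (EuclideanSpace.single i 1)

section PartialDeriv

variable {n : ℕ} {i j : Fin n} {f g : EuclideanSpace ℝ (Fin n) → ℝ}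
  {x : EuclideanSpace ℝ (Fin n)} {U : Set (EuclideanSpace ℝ (Fin n))}

theorem lap_eq_sum_partialDeriv :
    lap f x = ∑ i, partialDeriv i (partialDeriv i f) x := rfl

theorem partialDeriv_congr (hU : IsOpen U) (hx : x ∈ U) (hfg : ∀ y ∈ U, f y = g y) :
    partialDeriv i f x = partialDeriv i g x := by
  have h : f =ᶠ[𝓝 x] g := by
    filter_upwards [hU.mem_nhds hx] with y hy using hfg y hy
  rw [partialDeriv, partialDeriv, h.fderiv_eq]

theorem partialDeriv_add (hf : DifferentiableAt ℝ f x) (hg : DifferentiableAt ℝ g x) :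
    partialDeriv i (fun y => f y + g y) x = partialDeriv i f x + partialDeriv i g x := by
  simp [partialDeriv, fderiv_fun_add hf hg]

theorem partialDeriv_mul (hf : DifferentiableAt ℝ f x) (hg : DifferentiableAt ℝ g x) :
    partialDeriv i (fun y => f y * g y) x =
      f x * partialDeriv i g x + partialDeriv i f x * g x := by
  simp [partialDeriv, fderiv_fun_mul hf hg, mul_comm (g x)]

theorem partialDeriv_neg : partialDeriv i (fun y => -f y) x = -partialDeriv i f x := by
  simp [partialDeriv, fderiv_fun_neg]

theorem partialDeriv_sum {ι : Type*} {s : Finset ι} {F : ι → EuclideanSpace ℝ (Fin n) → ℝ}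
    (hF : ∀ k ∈ s, DifferentiableAt ℝ (F k) x) :
    partialDeriv i (fun y => ∑ k ∈ s, F k y) x = ∑ k ∈ s, partialDeriv i (F k) x := by
  simp [partialDeriv, fderiv_fun_sum hF]

theorem partialDeriv_comp {φ : ℝ → ℝ} (hφ : DifferentiableAt ℝ φ (f x))
    (hf : DifferentiableAt ℝ f x) :
    partialDeriv i (fun y => φ (f y)) x = deriv φ (f x) * partialDeriv i f x := by
  have h := hφ.hasDerivAt.comp_hasFDerivAt x hf.hasFDerivAt
  have h' : fderiv ℝ (fun y => φ (f y)) x = deriv φ (f x) • fderiv ℝ f x := h.fderiv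
  simp [partialDeriv, h']

theorem partialDeriv_sq (hf : DifferentiableAt ℝ f x) :
    partialDeriv i (fun y => f y ^ 2) x = 2 * f x * partialDeriv i f x := by
  simp only [pow_two]
  rw [partialDeriv_mul hf hf]
  ring

theorem contDiffOn_partialDeriv {m k : WithTop ℕ∞} (hU : IsOpen U) (hf : ContDiffOn ℝ k f U)
    (hmk : m + 1 ≤ k) : ContDiffOn ℝ m (partialDeriv i f) U :=
  (hf.fderiv_of_isOpen hU hmk).clm_apply contDiffOn_const

theorem partialDeriv_comm (hf : ContDiffAt ℝ 2 f x) :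
    partialDeriv i (partialDeriv j f) x = partialDeriv j (partialDeriv i f) x := by
  have hd : DifferentiableAt ℝ (fderiv ℝ f) x :=
    (hf.fderiv_right (m := 1) (by norm_num)).differentiableAt (by norm_num)
  have key : ∀ k l : Fin n, partialDeriv k (partialDeriv l f) x =
      fderiv ℝ (fderiv ℝ f) x (EuclideanSpace.single k 1) (EuclideanSpace.single l 1) := by
    intro k l
    change fderiv ℝ (fun y => fderiv ℝ f y (EuclideanSpace.single l 1)) x _ = _
    rw [fderiv_clm_apply hd (differentiableAt_const _)]
    simp
  rw [key, key]
  exact (hf.isSymmSndFDerivAt (by simp)).eq _ _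

theorem partialDeriv_eq_zero_of_isLocalMax (h : IsLocalMax f x) : partialDeriv i f x = 0 := by
  simp [partialDeriv, h.fderiv_eq_zero]

theorem partialDeriv_partialDeriv_nonpos_of_isLocalMax (hf : ContDiffAt ℝ 2 f x)
    (h : IsLocalMax f x) : partialDeriv i (partialDeriv i f) x ≤ 0 := by
  by_contra! hpos
  set e : EuclideanSpace ℝ (Fin n) := EuclideanSpace.single i 1
  set L : ℝ → EuclideanSpace ℝ (Fin n) := fun t => x + t • e with hLdef
  have hL0 : L 0 = x := by simp [hLdef]
  have hL : ∀ t, HasDerivAt L e t := fun t => by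
    have h1 : HasDerivAt (fun t : ℝ => t • e) e t := by
      simpa using (hasDerivAt_id t).smul_const e
    exact h1.const_add x
  have hLc : Tendsto L (𝓝 0) (𝓝 x) := by
    have := (hL 0).continuousAt.tendsto
    rwa [hL0] at this
  have hdiff : ∀ᶠ y in 𝓝 x, DifferentiableAt ℝ f y := by
    filter_upwards [hf.eventually (by simp)] with y hy using hy.differentiableAt (by norm_num)
  have hder : ∀ᶠ t in 𝓝 (0 : ℝ), deriv (fun t => f (L t)) t = partialDeriv i f (L t) := by
    filter_upwards [hLc.eventually hdiff] with t ht
    exact (ht.hasFDerivAt.comp_hasDerivAt t (hL t)).deriv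
  have hd2 : DifferentiableAt ℝ (partialDeriv i f) x :=
    (((hf.fderiv_right (m := 1) (by norm_num)).clm_apply contDiffAt_const).differentiableAt
      (by norm_num))
  have hdd : deriv (deriv (fun t => f (L t))) 0 = partialDeriv i (partialDeriv i f) x := by
    rw [EventuallyEq.deriv_eq hder]
    have h2 : HasFDerivAt (partialDeriv i f) (fderiv ℝ (partialDeriv i f) x) (L 0) := by
      rw [hL0]; exact hd2.hasFDerivAt
    exact (h2.comp_hasDerivAt (0 : ℝ) (hL 0)).deriv
  have hd0 : deriv (fun t => f (L t)) 0 = 0 := by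
    rw [hder.self_of_nhds, hL0, partialDeriv_eq_zero_of_isLocalMax h]
  have hcont : ContinuousAt (fun t => f (L t)) 0 := by
    apply ContinuousAt.comp (g := f) _ (hL 0).continuousAt
    rw [hL0]; exact hf.continuousAt
  have hmin := isLocalMin_of_deriv_deriv_pos (by rw [hdd]; exact hpos) hd0 hcont
  have hconst : (fun t => f (L t)) =ᶠ[𝓝 0] fun _ => f x := by
    filter_upwards [hmin, hLc.eventually h] with t h1 h2
    simp only [hL0] at h1
    exact le_antisymm h2 h1
  have h0 : deriv (deriv (fun t => f (L t))) 0 = 0 := by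
    rw [hconst.deriv.deriv_eq]; simp
  linarith

theorem norm_gradient_sq (f : EuclideanSpace ℝ (Fin n) → ℝ) (x : EuclideanSpace ℝ (Fin n)) :
    ‖gradient f x‖ ^ 2 = ∑ i, partialDeriv i f x ^ 2 := by
  rw [EuclideanSpace.norm_sq_eq]
  refine Finset.sum_congr rfl fun i _ => ?_
  have h : gradient f x i = partialDeriv i f x := by
    rw [partialDeriv, gradient, ← InnerProductSpace.toDual_symm_apply, real_inner_comm,
      EuclideanSpace.inner_single_left]
    simp
  rw [h, Real.norm_eq_abs, sq_abs]

end PartialDeriv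

section Bochner

variable {n : ℕ} {U : Set (EuclideanSpace ℝ (Fin n))} {w : EuclideanSpace ℝ (Fin n) → ℝ}
  {h : ℝ → ℝ}

/-- The quantity `|∇w|² + h(w)`, written in coordinates. -/
noncomputable def gradEnergy (h : ℝ → ℝ) (w : EuclideanSpace ℝ (Fin n) → ℝ)
    (x : EuclideanSpace ℝ (Fin n)) : ℝ :=
  ∑ j, partialDeriv j w x ^ 2 + h (w x)

theorem contDiffOn_gradEnergy (hU : IsOpen U) (hw : ContDiffOn ℝ 3 w U)
    (hh : ContDiff ℝ 2 h) : ContDiffOn ℝ 2 (gradEnergy h w) U := by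
  refine ContDiffOn.add (ContDiffOn.sum fun j _ => ?_)
    (hh.comp_contDiffOn (hw.of_le (by norm_num)))
  exact (contDiffOn_partialDeriv hU hw (by norm_num)).pow 2

theorem partialDeriv_gradEnergy (hU : IsOpen U) (hw : ContDiffOn ℝ 3 w U)
    (hh : ContDiff ℝ 2 h) (i : Fin n) {x : EuclideanSpace ℝ (Fin n)} (hx : x ∈ U) :
    partialDeriv i (gradEnergy h w) x =
      ∑ j, 2 * partialDeriv j w x * partialDeriv i (partialDeriv j w) x +
        deriv h (w x) * partialDeriv i w x := by
  have hxU := hU.mem_nhds hx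
  have d0 : DifferentiableAt ℝ w x := (hw.contDiffAt hxU).differentiableAt (by norm_num)
  have d1 : ∀ j, DifferentiableAt ℝ (partialDeriv j w) x := fun j =>
    ((contDiffOn_partialDeriv (m := 2) hU hw (by norm_num)).contDiffAt hxU).differentiableAt
      (by norm_num)
  have dh : DifferentiableAt ℝ h (w x) := (hh.differentiable (by norm_num)).differentiableAt
  have dc : DifferentiableAt ℝ (fun y => h (w y)) x := DifferentiableAt.comp x dh d0
  unfold gradEnergy
  rw [partialDeriv_add (DifferentiableAt.fun_sum fun j _ => (d1 j).fun_pow 2) dc,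
    partialDeriv_comp dh d0,
    partialDeriv_sum fun j _ => (d1 j).fun_pow 2]
  simp only [partialDeriv_sq (d1 _)]

theorem partialDeriv_partialDeriv_gradEnergy (hU : IsOpen U) (hw : ContDiffOn ℝ 3 w U)
    (hh : ContDiff ℝ 2 h) (i : Fin n) {x : EuclideanSpace ℝ (Fin n)} (hx : x ∈ U) :
    partialDeriv i (partialDeriv i (gradEnergy h w)) x =
      ∑ j, (2 * partialDeriv i (partialDeriv j w) x ^ 2 +
        2 * partialDeriv j w x * partialDeriv i (partialDeriv i (partialDeriv j w)) x) +
      (deriv (deriv h) (w x) * partialDeriv i w x ^ 2 +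
        deriv h (w x) * partialDeriv i (partialDeriv i w) x) := by
  have hxU := hU.mem_nhds hx
  have d0 : DifferentiableAt ℝ w x := (hw.contDiffAt hxU).differentiableAt (by norm_num)
  have c1 : ∀ j, ContDiffOn ℝ 2 (partialDeriv j w) U := fun j =>
    contDiffOn_partialDeriv (m := 2) hU hw (by norm_num)
  have d1 : ∀ j, DifferentiableAt ℝ (partialDeriv j w) x := fun j =>
    ((c1 j).contDiffAt hxU).differentiableAt (by norm_num)
  have d2 : ∀ j, DifferentiableAt ℝ (partialDeriv i (partialDeriv j w)) x := fun j =>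
    ((contDiffOn_partialDeriv (m := 1) hU (c1 j) (by norm_num)).contDiffAt hxU).differentiableAt
      (by norm_num)
  have dh : DifferentiableAt ℝ (deriv h) (w x) :=
    ((hh.iterate_deriv' 1 1).differentiable (by norm_num)).differentiableAt
  rw [partialDeriv_congr hU hx fun y hy => partialDeriv_gradEnergy hU hw hh i hy]
  have e1 : ∀ j, DifferentiableAt ℝ (fun y => 2 * partialDeriv j w y) x := fun j =>
    (d1 j).const_mul 2
  have e2 : ∀ j ∈ Finset.univ, DifferentiableAt ℝ
      (fun y => 2 * partialDeriv j w y * partialDeriv i (partialDeriv j w) y) x := fun j _ =>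
    (e1 j).fun_mul (d2 j)
  have e3 : ∀ j, partialDeriv i (fun y => 2 * partialDeriv j w y) x =
      2 * partialDeriv i (partialDeriv j w) x := fun j => by
    rw [partialDeriv_mul (differentiableAt_const _) (d1 j)]
    simp [partialDeriv]
  have e4 : DifferentiableAt ℝ (fun y => deriv h (w y)) x := DifferentiableAt.comp x dh d0
  rw [partialDeriv_add (DifferentiableAt.fun_sum e2) (e4.fun_mul (d1 i)), partialDeriv_sum e2,
    partialDeriv_mul e4 (d1 i), partialDeriv_comp dh d0]
  congr 1
  · refine Finset.sum_congr rfl fun j _ => ?_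
    rw [partialDeriv_mul (e1 j) (d2 j), e3]
    ring
  · ring

/-- The Bochner inequality for `|∇w|² + h(w)`, where `Δw + |∇w|² + h(w) = 0`. -/
theorem gradEnergy_bochner (hU : IsOpen U) (hw : ContDiffOn ℝ 3 w U)
    (hh : ContDiff ℝ 2 h) (h0 : ∀ s, 0 ≤ h s) (h1 : ∀ s, deriv h s ≤ 0)
    (h2 : ∀ s, deriv h s ≤ deriv (deriv h) s)
    (heq : ∀ x ∈ U, ∑ i, partialDeriv i (partialDeriv i w) x + gradEnergy h w x = 0)
    {x : EuclideanSpace ℝ (Fin n)} (hx : x ∈ U) :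
    2 * gradEnergy h w x ^ 2 ≤
      n * (∑ i, partialDeriv i (partialDeriv i (gradEnergy h w)) x +
        2 * ∑ j, partialDeriv j w x * partialDeriv j (gradEnergy h w) x) := by
  have hxU := hU.mem_nhds hx
  have c1 : ∀ j, ContDiffOn ℝ 2 (partialDeriv j w) U := fun j =>
    contDiffOn_partialDeriv (m := 2) hU hw (by norm_num)
  have d2 : ∀ i j, DifferentiableAt ℝ (partialDeriv i (partialDeriv j w)) x := fun i j =>
    ((contDiffOn_partialDeriv (m := 1) hU (c1 j) (by norm_num)).contDiffAt hxU).differentiableAt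
      (by norm_num)
  have third : ∀ i j, partialDeriv i (partialDeriv i (partialDeriv j w)) x =
      partialDeriv j (partialDeriv i (partialDeriv i w)) x := fun i j => by
    rw [← partialDeriv_comm ((c1 i).contDiffAt hxU)]
    exact partialDeriv_congr hU hx fun y hy => partialDeriv_comm
      ((hw.contDiffAt (hU.mem_nhds hy)).of_le (by norm_num))
  have gradF : ∀ j, ∑ i, partialDeriv i (partialDeriv i (partialDeriv j w)) x =
      -partialDeriv j (gradEnergy h w) x := fun j => by
    have : partialDeriv j (gradEnergy h w) x =
        partialDeriv j (fun y => -∑ i, partialDeriv i (partialDeriv i w) y) x :=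
      partialDeriv_congr hU hx fun y hy => by linarith [heq y hy]
    rw [this, partialDeriv_neg, partialDeriv_sum fun i _ => d2 i i, neg_neg]
    exact Finset.sum_congr rfl fun i _ => third i j
  have lapF : ∑ i, partialDeriv i (partialDeriv i (gradEnergy h w)) x =
      2 * ∑ i, ∑ j, partialDeriv i (partialDeriv j w) x ^ 2 -
      2 * ∑ j, partialDeriv j w x * partialDeriv j (gradEnergy h w) x +
      (deriv (deriv h) (w x) * ∑ i, partialDeriv i w x ^ 2 -
        deriv h (w x) * gradEnergy h w x) := by
    have hlap : ∑ i, partialDeriv i (partialDeriv i w) x = -gradEnergy h w x := by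
      linarith [heq x hx]
    have hcross : ∑ i, ∑ j, 2 * partialDeriv j w x *
        partialDeriv i (partialDeriv i (partialDeriv j w)) x =
        -(2 * ∑ j, partialDeriv j w x * partialDeriv j (gradEnergy h w) x) := by
      rw [Finset.sum_comm, Finset.mul_sum, ← Finset.sum_neg_distrib]
      refine Finset.sum_congr rfl fun j _ => ?_
      rw [← Finset.mul_sum, gradF]
      ring
    simp only [partialDeriv_partialDeriv_gradEnergy hU hw hh _ hx, Finset.sum_add_distrib,
      hcross, ← Finset.mul_sum, hlap]
    ring
  have hess : gradEnergy h w x ^ 2 ≤ n * ∑ i, ∑ j, partialDeriv i (partialDeriv j w) x ^ 2 := by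
    have hlap : gradEnergy h w x ^ 2 = (∑ i, partialDeriv i (partialDeriv i w) x) ^ 2 := by
      rw [show gradEnergy h w x = -∑ i, partialDeriv i (partialDeriv i w) x by
        linarith [heq x hx], neg_sq]
    rw [hlap]
    refine (sq_sum_le_card_mul_sum_sq (s := Finset.univ)).trans ?_
    rw [Finset.card_univ, Fintype.card_fin]
    gcongr with i
    exact Finset.single_le_sum (f := fun j => partialDeriv i (partialDeriv j w) x ^ 2)
      (fun j _ => sq_nonneg _) (Finset.mem_univ i)
  have hrest : 0 ≤ deriv (deriv h) (w x) * ∑ i, partialDeriv i w x ^ 2 -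
      deriv h (w x) * gradEnergy h w x := by
    have hS : 0 ≤ ∑ i, partialDeriv i w x ^ 2 := Finset.sum_nonneg fun i _ => sq_nonneg _
    have hF : gradEnergy h w x = ∑ i, partialDeriv i w x ^ 2 + h (w x) := rfl
    rw [hF]
    nlinarith [mul_nonneg (sub_nonneg.2 (h2 (w x))) hS,
      mul_nonneg (neg_nonneg.2 (h1 (w x))) (h0 (w x))]
  rw [lapF]
  nlinarith [mul_nonneg (Nat.cast_nonneg (α := ℝ) n) hrest]

end Bochner

section Cutoff

variable {n : ℕ} {ρ : ℝ} {x : EuclideanSpace ℝ (Fin n)} {i : Fin n}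

/-- The cutoff `ρ² - |y|²`, positive exactly inside the ball of radius `ρ`. -/
noncomputable def ballCutoff (ρ : ℝ) (y : EuclideanSpace ℝ (Fin n)) : ℝ := ρ ^ 2 - ‖y‖ ^ 2

theorem contDiff_ballCutoff {k : WithTop ℕ∞} :
    ContDiff ℝ k (ballCutoff ρ : EuclideanSpace ℝ (Fin n) → ℝ) :=
  contDiff_const.sub (contDiff_norm_sq ℝ)

theorem partialDeriv_ballCutoff : partialDeriv i (ballCutoff ρ) x = -2 * x i := by
  have h : HasFDerivAt (ballCutoff ρ) (-(2 • innerSL ℝ x)) x :=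
    (hasStrictFDerivAt_norm_sq x).hasFDerivAt.const_sub (ρ ^ 2)
  rw [partialDeriv, h.fderiv]
  simp [EuclideanSpace.inner_single_right]

theorem partialDeriv_coord : partialDeriv i (fun y => y i) x = 1 := by
  have h : HasFDerivAt (fun y : EuclideanSpace ℝ (Fin n) => y i)
      (EuclideanSpace.proj i : EuclideanSpace ℝ (Fin n) →L[ℝ] ℝ) x :=
    (EuclideanSpace.proj i : EuclideanSpace ℝ (Fin n) →L[ℝ] ℝ).hasFDerivAt
  rw [partialDeriv, h.fderiv]
  simp

theorem partialDeriv_ballCutoff_sq :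
    partialDeriv i (fun y => ballCutoff ρ y ^ 2) x = -4 * (ballCutoff ρ x * x i) := by
  have d : DifferentiableAt ℝ (ballCutoff ρ) x :=
    ((contDiff_ballCutoff (k := 1)).differentiable (by norm_num)).differentiableAt
  rw [partialDeriv_sq d, partialDeriv_ballCutoff]
  ring

theorem partialDeriv_partialDeriv_ballCutoff_sq :
    partialDeriv i (partialDeriv i (fun y => ballCutoff ρ y ^ 2)) x =
      8 * x i ^ 2 - 4 * ballCutoff ρ x := by
  have d : DifferentiableAt ℝ (ballCutoff ρ) x :=
    ((contDiff_ballCutoff (k := 1)).differentiable (by norm_num)).differentiableAt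
  have dc : DifferentiableAt ℝ (fun y : EuclideanSpace ℝ (Fin n) => y i) x :=
    (EuclideanSpace.proj i : EuclideanSpace ℝ (Fin n) →L[ℝ] ℝ).differentiableAt
  rw [partialDeriv_congr isOpen_univ (Set.mem_univ x) fun y _ => partialDeriv_ballCutoff_sq,
    partialDeriv_mul (differentiableAt_const _) (d.fun_mul dc), partialDeriv_mul d dc,
    partialDeriv_coord, partialDeriv_ballCutoff]
  simp [partialDeriv]
  ring

end Cutoff

theorem partialDeriv_partialDeriv_mul {n : ℕ} {i : Fin n} {f g : EuclideanSpace ℝ (Fin n) → ℝ}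
    {x : EuclideanSpace ℝ (Fin n)} {U : Set (EuclideanSpace ℝ (Fin n))} (hU : IsOpen U)
    (hx : x ∈ U) (hf : ContDiffOn ℝ 2 f U) (hg : ContDiffOn ℝ 2 g U) :
    partialDeriv i (partialDeriv i (fun y => f y * g y)) x =
      f x * partialDeriv i (partialDeriv i g) x +
        2 * (partialDeriv i f x * partialDeriv i g x) +
        partialDeriv i (partialDeriv i f) x * g x := by
  have d : ∀ {φ : EuclideanSpace ℝ (Fin n) → ℝ}, ContDiffOn ℝ 2 φ U → ∀ y ∈ U,
      DifferentiableAt ℝ φ y := fun hφ y hy =>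
    (hφ.contDiffAt (hU.mem_nhds hy)).differentiableAt (by norm_num)
  have d' : ∀ {φ : EuclideanSpace ℝ (Fin n) → ℝ}, ContDiffOn ℝ 2 φ U →
      DifferentiableAt ℝ (partialDeriv i φ) x := fun hφ =>
    ((contDiffOn_partialDeriv (m := 1) hU hφ (by norm_num)).contDiffAt
      (hU.mem_nhds hx)).differentiableAt (by norm_num)
  rw [partialDeriv_congr hU hx fun y hy => partialDeriv_mul (d hf y hy) (d hg y hy),
    partialDeriv_add ((d hf x hx).fun_mul (d' hg)) ((d' hf).fun_mul (d hg x hx)),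
    partialDeriv_mul (d hf x hx) (d' hg), partialDeriv_mul (d' hf) (d hg x hx)]
  ring

/-- The localized estimate at an interior maximum of `(ρ² - |y|²)² (|∇w|² + h(w))`. -/
theorem ballCutoff_sq_mul_gradEnergy_le_of_isLocalMax {n : ℕ} (hn : 1 ≤ n)
    {U : Set (EuclideanSpace ℝ (Fin n))} {w : EuclideanSpace ℝ (Fin n) → ℝ} {h : ℝ → ℝ}
    (hU : IsOpen U) (hw : ContDiffOn ℝ 3 w U)
    (hh : ContDiff ℝ 2 h) (h0 : ∀ s, 0 ≤ h s) (h1 : ∀ s, deriv h s ≤ 0)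
    (h2 : ∀ s, deriv h s ≤ deriv (deriv h) s)
    (heq : ∀ x ∈ U, ∑ i, partialDeriv i (partialDeriv i w) x + gradEnergy h w x = 0)
    {ρ : ℝ} {x : EuclideanSpace ℝ (Fin n)} (hx : x ∈ U) (hρ : 0 < ballCutoff ρ x)
    (hmax : IsLocalMax (fun y => ballCutoff ρ y ^ 2 * gradEnergy h w y) x) :
    ballCutoff ρ x ^ 2 * gradEnergy h w x ≤ (20 * n ^ 2 + 24 * n) * ρ ^ 2 := by
  have hn' : (1 : ℝ) ≤ n := by exact_mod_cast hn
  have hF2 := contDiffOn_gradEnergy hU hw hh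
  have hφ2 : ContDiffOn ℝ 2 (fun y : EuclideanSpace ℝ (Fin n) => ballCutoff ρ y ^ 2) U :=
    (contDiff_ballCutoff.pow 2).contDiffOn
  have hxU := hU.mem_nhds hx
  have hboch := gradEnergy_bochner hU hw hh h0 h1 h2 heq hx
  have hS : ∑ i, partialDeriv i w x ^ 2 ≤ gradEnergy h w x := by
    simp [gradEnergy, h0]
  have hF0 : 0 ≤ gradEnergy h w x := (Finset.sum_nonneg fun i _ => sq_nonneg _).trans hS
  have hnorm : ∑ i, x i ^ 2 = ‖x‖ ^ 2 := (EuclideanSpace.real_norm_sq_eq x).symm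
  have hψ : ballCutoff ρ x = ρ ^ 2 - ‖x‖ ^ 2 := rfl
  set F := gradEnergy h w x
  set ψ := ballCutoff ρ x
  rcases hF0.eq_or_lt with hF00 | hFpos
  · rw [← hF00, mul_zero]; positivity
  have hgrad : ∀ i, ψ * partialDeriv i (gradEnergy h w) x = 4 * F * x i := fun i => by
    have := partialDeriv_eq_zero_of_isLocalMax (i := i) hmax
    rw [partialDeriv_mul ((hφ2.contDiffAt hxU).differentiableAt (by norm_num))
      ((hF2.contDiffAt hxU).differentiableAt (by norm_num)), partialDeriv_ballCutoff_sq] at this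
    apply mul_left_cancel₀ hρ.ne'
    linarith
  have hlap : ∀ i, ψ ^ 2 * partialDeriv i (partialDeriv i (gradEnergy h w)) x ≤
      F * (24 * x i ^ 2 + 4 * ψ) := fun i => by
    have := partialDeriv_partialDeriv_nonpos_of_isLocalMax (i := i)
      ((hφ2.mul hF2).contDiffAt hxU) hmax
    rw [partialDeriv_partialDeriv_mul hU hx hφ2 hF2, partialDeriv_partialDeriv_ballCutoff_sq,
      partialDeriv_ballCutoff_sq] at this
    have e : -4 * (ψ * x i) * partialDeriv i (gradEnergy h w) x = -16 * F * x i ^ 2 := by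
      linear_combination (-4 * x i) * hgrad i
    rw [e] at this
    linarith
  have hlapsum : ψ ^ 2 * ∑ i, partialDeriv i (partialDeriv i (gradEnergy h w)) x ≤
      F * (24 * ‖x‖ ^ 2 + 4 * n * ψ) := by
    rw [Finset.mul_sum]
    refine (Finset.sum_le_sum fun i _ => hlap i).trans_eq ?_
    rw [← Finset.mul_sum, Finset.sum_add_distrib, ← Finset.mul_sum, hnorm, Finset.sum_const,
      Finset.card_univ, Fintype.card_fin, nsmul_eq_mul]
    ring
  have hcross : n * (ψ ^ 2 * (2 * ∑ j, partialDeriv j w x * partialDeriv j (gradEnergy h w) x)) ≤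
      F * (ψ ^ 2 * F + 16 * n ^ 2 * ‖x‖ ^ 2) := by
    have e : n * (ψ ^ 2 * (2 * ∑ j, partialDeriv j w x * partialDeriv j (gradEnergy h w) x)) =
        F * ∑ j, 8 * n * ψ * (partialDeriv j w x * x j) := by
      simp only [Finset.mul_sum]
      refine Finset.sum_congr rfl fun j _ => ?_
      linear_combination (2 * n * ψ * partialDeriv j w x) * hgrad j
    rw [e]
    refine mul_le_mul_of_nonneg_left ?_ hF0
    calc ∑ j, 8 * n * ψ * (partialDeriv j w x * x j)
        ≤ ∑ j, (ψ ^ 2 * partialDeriv j w x ^ 2 + 16 * n ^ 2 * x j ^ 2) :=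
          Finset.sum_le_sum fun j _ => by
            nlinarith [sq_nonneg (ψ * partialDeriv j w x - 4 * n * x j)]
      _ = ψ ^ 2 * ∑ j, partialDeriv j w x ^ 2 + 16 * n ^ 2 * ‖x‖ ^ 2 := by
          rw [Finset.sum_add_distrib, ← Finset.mul_sum, ← Finset.mul_sum, hnorm]
      _ ≤ ψ ^ 2 * F + 16 * n ^ 2 * ‖x‖ ^ 2 := by gcongr
  have hmain : F * (ψ ^ 2 * F) ≤ F * (16 * n ^ 2 * ‖x‖ ^ 2 + n * (24 * ‖x‖ ^ 2 + 4 * n * ψ)) := by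
    have a1 := mul_le_mul_of_nonneg_left hboch (sq_nonneg ψ)
    have a2 := mul_le_mul_of_nonneg_left hlapsum (zero_le_one.trans hn')
    linarith
  have hmain' := le_of_mul_le_mul_left hmain hFpos
  have hxρ : ‖x‖ ^ 2 ≤ ρ ^ 2 := by linarith
  have hψρ : ψ ≤ ρ ^ 2 := by linarith [sq_nonneg ‖x‖]
  calc ψ ^ 2 * F ≤ 16 * n ^ 2 * ‖x‖ ^ 2 + n * (24 * ‖x‖ ^ 2 + 4 * n * ψ) := hmain'
    _ ≤ 16 * n ^ 2 * ρ ^ 2 + n * (24 * ρ ^ 2 + 4 * n * ρ ^ 2) := by gcongr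
    _ = (20 * n ^ 2 + 24 * n) * ρ ^ 2 := by ring

theorem ballCutoff_sq_mul_gradEnergy_le {n : ℕ} (hn : 1 ≤ n)
    {U : Set (EuclideanSpace ℝ (Fin n))} {w : EuclideanSpace ℝ (Fin n) → ℝ} {h : ℝ → ℝ}
    (hU : IsOpen U) (hw : ContDiffOn ℝ 3 w U)
    (hh : ContDiff ℝ 2 h) (h0 : ∀ s, 0 ≤ h s) (h1 : ∀ s, deriv h s ≤ 0)
    (h2 : ∀ s, deriv h s ≤ deriv (deriv h) s)
    (heq : ∀ x ∈ U, ∑ i, partialDeriv i (partialDeriv i w) x + gradEnergy h w x = 0)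
    {ρ : ℝ} (hρ : 0 < ρ) (hρU : closedBall 0 ρ ⊆ U) {x : EuclideanSpace ℝ (Fin n)}
    (hx : x ∈ closedBall 0 ρ) :
    ballCutoff ρ x ^ 2 * gradEnergy h w x ≤ (20 * n ^ 2 + 24 * n) * ρ ^ 2 := by
  have hcont : ContinuousOn (fun y => ballCutoff ρ y ^ 2 * gradEnergy h w y) (closedBall 0 ρ) :=
    ((contDiff_ballCutoff (k := 0)).continuous.pow 2).continuousOn.mul
      ((contDiffOn_gradEnergy hU hw hh).continuousOn.mono hρU)
  obtain ⟨z, hz, hzmax⟩ := (isCompact_closedBall (0 : EuclideanSpace ℝ (Fin n)) ρ).exists_isMaxOn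
    ⟨x, hx⟩ hcont
  refine (hzmax hx).trans ?_
  have hzn : ‖z‖ ≤ ρ := by simpa using hz
  rcases hzn.eq_or_lt with hzρ | hzρ
  · have : ballCutoff ρ z = 0 := by simp [ballCutoff, hzρ]
    simp only [this]
    rw [zero_pow two_ne_zero, zero_mul]
    positivity
  · refine ballCutoff_sq_mul_gradEnergy_le_of_isLocalMax hn hU hw hh h0 h1 h2 heq (hρU hz) ?_
      (hzmax.isLocalMax ?_)
    · have := pow_lt_pow_left₀ hzρ (norm_nonneg z) two_ne_zero
      simpa [ballCutoff] using this
    · exact mem_of_superset (isOpen_ball.mem_nhds (by simpa using hzρ)) ball_subset_closedBall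

theorem partialDeriv_log {n : ℕ} {i : Fin n} {u : EuclideanSpace ℝ (Fin n) → ℝ}
    {x : EuclideanSpace ℝ (Fin n)} (hu : DifferentiableAt ℝ u x) (hx : 0 < u x) :
    partialDeriv i (fun y => Real.log (u y)) x = partialDeriv i u x / u x := by
  rw [partialDeriv_comp (Real.differentiableAt_log hx.ne') hu, Real.deriv_log, inv_mul_eq_div]

theorem partialDeriv_partialDeriv_log {n : ℕ} {i : Fin n} {u : EuclideanSpace ℝ (Fin n) → ℝ}
    {x : EuclideanSpace ℝ (Fin n)} {U : Set (EuclideanSpace ℝ (Fin n))} (hU : IsOpen U)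
    (hu : ContDiffOn ℝ 2 u U) (hpos : ∀ y ∈ U, 0 < u y) (hx : x ∈ U) :
    partialDeriv i (partialDeriv i (fun y => Real.log (u y))) x =
      partialDeriv i (partialDeriv i u) x / u x - (partialDeriv i u x / u x) ^ 2 := by
  have d : ∀ y ∈ U, DifferentiableAt ℝ u y := fun y hy =>
    (hu.contDiffAt (hU.mem_nhds hy)).differentiableAt (by norm_num)
  have d1 : DifferentiableAt ℝ (partialDeriv i u) x :=
    ((contDiffOn_partialDeriv (m := 1) hU hu (by norm_num)).contDiffAt
      (hU.mem_nhds hx)).differentiableAt (by norm_num)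
  have hux := (hpos x hx).ne'
  have d2 : DifferentiableAt ℝ (fun y => (u y)⁻¹) x := (d x hx).fun_inv hux
  have e : partialDeriv i (fun y => (u y)⁻¹) x = -(u x ^ 2)⁻¹ * partialDeriv i u x := by
    rw [partialDeriv_comp (φ := fun t => t⁻¹) (differentiableAt_inv hux) (d x hx), deriv_inv]
  rw [partialDeriv_congr hU hx fun y hy =>
    (partialDeriv_log (d y hy) (hpos y hy)).trans (div_eq_mul_inv _ _),
    partialDeriv_mul d1 d2, e]
  field_simp
  ring

/-- Corollary 1.4 (Euclidean case `K = 0`, `λ = 1`): gradient estimate for positive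
solutions of `Δu + u h(ln u) = 0` when `h ≥ 0`, `h' ≤ 0` and `h' ≤ h''`. -/
theorem stmt_8 (n : ℕ) (hn : 1 ≤ n) :
    ∃ c : ℝ, 0 < c ∧
      ∀ h : ℝ → ℝ, ContDiff ℝ 2 h →
        (∀ s : ℝ, h s ≥ 0) →
        (∀ s : ℝ, deriv h s ≤ 0) →
        (∀ s : ℝ, deriv h s ≤ deriv (deriv h) s) →
        ∀ R : ℝ, 0 < R →
          ∀ u : EuclideanSpace ℝ (Fin n) → ℝ,
            ContDiffOn ℝ (⊤ : ℕ∞) u (ball (0 : EuclideanSpace ℝ (Fin n)) (2 * R)) →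
            (∀ x ∈ ball (0 : EuclideanSpace ℝ (Fin n)) (2 * R), 0 < u x) →
            (∀ x ∈ ball (0 : EuclideanSpace ℝ (Fin n)) (2 * R),
              lap u x + u x * h (Real.log (u x)) = 0) →
            ∀ x ∈ ball (0 : EuclideanSpace ℝ (Fin n)) R,
              ‖gradient u x‖ ^ 2 / u x ^ 2 + h (Real.log (u x)) ≤ c / R ^ 2 ∧
              ‖gradient u x‖ / u x ≤ Real.sqrt c / R := by
  refine ⟨100 * n ^ 2, by positivity, fun h hh h0 h1 h2 R hR u hu hpos hequ x hx => ?_⟩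
  have hn' : (1 : ℝ) ≤ n := by exact_mod_cast hn
  have hU : IsOpen (ball (0 : EuclideanSpace ℝ (Fin n)) (2 * R)) := isOpen_ball
  have hu3 : ContDiffOn ℝ 3 u (ball 0 (2 * R)) :=
    hu.of_le (WithTop.coe_le_coe.2 (le_top : (3 : ℕ∞) ≤ ⊤))
  have hu2 : ContDiffOn ℝ 2 u (ball 0 (2 * R)) := hu3.of_le (by norm_num)
  have hw : ContDiffOn ℝ 3 (fun y => Real.log (u y)) (ball 0 (2 * R)) :=
    hu3.log fun y hy => (hpos y hy).ne'
  have hF : ∀ y ∈ ball (0 : EuclideanSpace ℝ (Fin n)) (2 * R),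
      gradEnergy h (fun y => Real.log (u y)) y =
        ‖gradient u y‖ ^ 2 / u y ^ 2 + h (Real.log (u y)) := fun y hy => by
    have d := (hu2.contDiffAt (hU.mem_nhds hy)).differentiableAt (by norm_num)
    simp only [gradEnergy, partialDeriv_log d (hpos y hy), norm_gradient_sq, div_pow,
      Finset.sum_div]
  have heq : ∀ y ∈ ball (0 : EuclideanSpace ℝ (Fin n)) (2 * R),
      ∑ i, partialDeriv i (partialDeriv i fun y => Real.log (u y)) y +
        gradEnergy h (fun y => Real.log (u y)) y = 0 := fun y hy => by
    have huy := (hpos y hy).ne'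
    have hE := hequ y hy
    rw [hF y hy, norm_gradient_sq]
    simp only [partialDeriv_partialDeriv_log hU hu2 hpos hy, Finset.sum_sub_distrib, div_pow,
      ← Finset.sum_div]
    rw [← lap_eq_sum_partialDeriv, show lap u y = -(u y * h (Real.log (u y))) by linarith]
    field_simp
    ring
  have hxR : ‖x‖ < R := by simpa using hx
  have hxU : x ∈ ball (0 : EuclideanSpace ℝ (Fin n)) (2 * R) := ball_subset_ball (by linarith) hx
  have key := ballCutoff_sq_mul_gradEnergy_le hn hU hw hh h0 h1 h2 heq
    (ρ := 3 / 2 * R) (by positivity) (closedBall_subset_ball (by linarith)) (x := x)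
    (mem_closedBall_zero_iff.2 (by linarith))
  have hψ : 5 / 4 * R ^ 2 ≤ ballCutoff (3 / 2 * R) x := by
    have := pow_le_pow_left₀ (norm_nonneg x) hxR.le 2
    unfold ballCutoff
    linarith
  rw [hF x hxU] at key
  have hux := hpos x hxU
  have hG : 0 ≤ ‖gradient u x‖ ^ 2 / u x ^ 2 := by positivity
  have hbound : ‖gradient u x‖ ^ 2 / u x ^ 2 + h (Real.log (u x)) ≤ 100 * n ^ 2 / R ^ 2 := by
    have hF0 := add_nonneg hG (h0 (Real.log (u x)))
    rw [le_div_iff₀ (by positivity)]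
    have hsq := pow_le_pow_left₀ (by positivity) hψ 2
    have h3 := (mul_le_mul_of_nonneg_right hsq hF0).trans key
    have hR2 : 0 < R ^ 2 := by positivity
    have h4 := le_of_mul_le_mul_left (a := R ^ 2)
      (b := 25 / 16 * ((‖gradient u x‖ ^ 2 / u x ^ 2 + h (Real.log (u x))) * R ^ 2))
      (c := (20 * n ^ 2 + 24 * n) * (9 / 4)) (by linarith) hR2
    nlinarith
  refine ⟨hbound, ?_⟩
  have hsq : (‖gradient u x‖ / u x) ^ 2 ≤ 100 * n ^ 2 / R ^ 2 := by
    rw [div_pow]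
    linarith [h0 (Real.log (u x))]
  rw [← Real.sqrt_sq hR.le, ← Real.sqrt_div (by positivity)]
  exact Real.le_sqrt_of_sq_le hsq
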